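/- Suppose there exist positive constants C₁, C₂, C₃, C₄, a real s₀ > 0, a real s₁, and ν ∈ (0,1) such that C₁·exp(−C₂ s^ν) ≤ G_N(s) ≤ C₃·exp(−C₄ s^ν) holds for all s > s₀ and all N > s₁ + (ν/log 2)·log s. Then there exist positive constants C₅ and C₆ such that for every sequence (α_N) of positive reals with α_N → 0 and 2^{N(1−ν)/ν}·α_N → ∞ as N → ∞, one has −C₅ ≤ liminf_{N→∞} α_N^{ν/(1−ν)}·log μ_N([0, α_N]) ≤ limsup_{N→∞} α_N^{ν/(1−ν)}·log μ_N([0, α_N]) ≤ −C₆. -/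

import Mathlib

open MeasureTheory Filter

section LaplaceTail

variable {m : Measure ℝ}

lemma ae_nonneg_of_measure_Iio_eq_zero (hm : m (Set.Iio 0) = 0) :
    ∀ᵐ x ∂m, 0 ≤ x := by
  rw [ae_iff]
  simpa [Set.Iio] using hm

variable [IsProbabilityMeasure m]

lemma integrable_exp_neg_mul (hm : m (Set.Iio 0) = 0) {s : ℝ} (hs : 0 ≤ s) :
    Integrable (fun x => Real.exp (-(s * x))) m := by
  refine Integrable.of_bound (C := 1) (by fun_prop) ?_
  filter_upwards [ae_nonneg_of_measure_Iio_eq_zero hm] with x hx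
  rw [Real.norm_eq_abs, Real.abs_exp, Real.exp_le_one_iff]
  nlinarith [mul_nonneg hs hx]

lemma measureReal_Icc_le_exp_mul_laplace (hm : m (Set.Iio 0) = 0) {s : ℝ} (hs : 0 ≤ s) (a : ℝ) :
    m.real (Set.Icc 0 a) ≤ Real.exp (s * a) * ∫ x, Real.exp (-(s * x)) ∂m := by
  rw [← integral_const_mul, ← integral_indicator_one measurableSet_Icc]
  refine integral_mono ((integrable_const (1 : ℝ)).indicator measurableSet_Icc)
    ((integrable_exp_neg_mul hm hs).const_mul _) fun x => ?_
  by_cases hx : x ∈ Set.Icc 0 a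
  · simp only [Set.indicator_of_mem hx, Pi.one_apply, ← Real.exp_add, Real.one_le_exp_iff]
    nlinarith [mul_le_mul_of_nonneg_left hx.2 hs]
  · simp only [Set.indicator_of_notMem hx]
    positivity

lemma laplace_le_measureReal_Icc_add_exp (hm : m (Set.Iio 0) = 0) {s : ℝ} (hs : 0 ≤ s) (a : ℝ) :
    ∫ x, Real.exp (-(s * x)) ∂m ≤ m.real (Set.Icc 0 a) + Real.exp (-(s * a)) := by
  have hind : Integrable ((Set.Icc 0 a).indicator (1 : ℝ → ℝ)) m :=
    (integrable_const (1 : ℝ)).indicator measurableSet_Icc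
  have hsum : m.real (Set.Icc 0 a) + Real.exp (-(s * a)) =
      ∫ x, ((Set.Icc 0 a).indicator (1 : ℝ → ℝ) x + Real.exp (-(s * a))) ∂m := by
    rw [integral_add hind (integrable_const _), integral_indicator_one measurableSet_Icc]
    simp
  rw [hsum]
  refine integral_mono_ae (integrable_exp_neg_mul hm hs) (hind.add (integrable_const _)) ?_
  filter_upwards [ae_nonneg_of_measure_Iio_eq_zero hm] with x hx
  by_cases hxa : x ≤ a
  · have hmem : x ∈ Set.Icc 0 a := ⟨hx, hxa⟩
    simp only [Set.indicator_of_mem hmem, Pi.one_apply]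
    have h1 : Real.exp (-(s * x)) ≤ 1 := Real.exp_le_one_iff.2 (by nlinarith [mul_nonneg hs hx])
    linarith [Real.exp_pos (-(s * a))]
  · have hmem : x ∉ Set.Icc 0 a := fun h => hxa h.2
    simp only [Set.indicator_of_notMem hmem, zero_add]
    exact Real.exp_le_exp.2 (by nlinarith [mul_le_mul_of_nonneg_left (not_le.1 hxa).le hs])

end LaplaceTail

section Scale

variable {α : ℕ → ℝ} {ν : ℝ}

lemma tendsto_rpow_neg_atTop_of_tendsto_zero (hpos : ∀ N, 0 < α N)
    (hα : Tendsto α atTop (nhds 0)) {β : ℝ} (hβ : 0 < β) :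
    Tendsto (fun N => α N ^ (-β)) atTop atTop :=
  (tendsto_rpow_neg_nhdsGT_zero (neg_lt_zero.2 hβ)).comp
    (tendsto_nhdsWithin_iff.2 ⟨hα, .of_forall hpos⟩)

lemma eventually_log_scale_lt (hν0 : 0 < ν) (hν1 : ν < 1) (hpos : ∀ N, 0 < α N)
    (hgrow : Tendsto (fun N : ℕ => (2 : ℝ) ^ ((N : ℝ) * (1 - ν) / ν) * α N) atTop atTop)
    {K : ℝ} (hK : 0 < K) (s₁ : ℝ) :
    ∀ᶠ N : ℕ in atTop,
      s₁ + ν / Real.log 2 * Real.log (K * α N ^ (-(1 / (1 - ν)))) < (N : ℝ) := by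
  have hν : 0 < 1 - ν := sub_pos.2 hν1
  have hlog2 : 0 < Real.log 2 := Real.log_pos one_lt_two
  set c : ℝ := ν / ((1 - ν) * Real.log 2) with hc
  have hcpos : 0 < c := by positivity
  have hlim := (Real.tendsto_log_atTop.comp hgrow).const_mul_atTop hcpos
  filter_upwards [hlim.eventually_gt_atTop (s₁ + ν / Real.log 2 * Real.log K)] with N hN
  have ha := hpos N
  simp only [Function.comp_apply] at hN
  rw [Real.log_mul (by positivity) ha.ne', Real.log_rpow two_pos] at hN
  rw [Real.log_mul hK.ne' (by positivity), Real.log_rpow ha]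
  have hmain : c * ((N : ℝ) * (1 - ν) / ν * Real.log 2 + Real.log (α N)) =
      N - ν / Real.log 2 * (-(1 / (1 - ν)) * Real.log (α N)) := by
    rw [hc]; field_simp; ring
  rw [hmain] at hN
  linarith [mul_add (ν / Real.log 2) (Real.log K) (-(1 / (1 - ν)) * Real.log (α N))]

lemma scale_mul_self (hν1 : ν < 1) {a : ℝ} (ha : 0 < a) (K : ℝ) :
    K * a ^ (-(1 / (1 - ν))) * a = K * a ^ (-(ν / (1 - ν))) := by
  have hν : 1 - ν ≠ 0 := (sub_pos.2 hν1).ne'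
  have hexp : -(ν / (1 - ν)) = -(1 / (1 - ν)) + 1 := by field_simp; ring
  rw [hexp, Real.rpow_add ha, Real.rpow_one, mul_assoc]

lemma scale_rpow {a K : ℝ} (ha : 0 < a) (hK : 0 < K) :
    (K * a ^ (-(1 / (1 - ν)))) ^ ν = K ^ ν * a ^ (-(ν / (1 - ν))) := by
  rw [Real.mul_rpow hK.le (by positivity), ← Real.rpow_mul ha.le]
  congr 2
  ring

lemma exists_pos_eq_mul_rpow (hν1 : ν < 1) {c : ℝ} (hc : 0 < c) :
    ∃ K > 0, K = c * K ^ ν := by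
  have hν : 1 - ν ≠ 0 := (sub_pos.2 hν1).ne'
  refine ⟨c ^ (1 / (1 - ν)), by positivity, ?_⟩
  rw [← Real.rpow_mul hc.le]
  nth_rewrite 2 [← Real.rpow_one c]
  rw [← Real.rpow_add hc]
  congr 1
  field_simp
  ring

end Scale

/-- Exponential Tauberian theorem (left tail, liminf/limsup form): if the Laplace
transforms G_N(s) = ∫ e^{−sx} μ_N(dx) of a family of probability measures μ_N on [0,∞)
satisfy C₁·exp(−C₂ s^ν) ≤ G_N(s) ≤ C₃·exp(−C₄ s^ν) for all s > s₀ and all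
N > s₁ + (ν/log 2)·log s, then there exist C₅, C₆ > 0 such that for every positive
sequence α_N with α_N → 0 and 2^{N(1−ν)/ν}·α_N → ∞,
−C₅ ≤ liminf α_N^{ν/(1−ν)}·log μ_N([0,α_N]) ≤ limsup α_N^{ν/(1−ν)}·log μ_N([0,α_N]) ≤ −C₆. -/
theorem tauberian_liminf_limsup
    (μ : ℕ → Measure ℝ) (hprob : ∀ N, IsProbabilityMeasure (μ N))
    (hsupp : ∀ N, μ N (Set.Iio 0) = 0)
    (ν : ℝ) (hν0 : 0 < ν) (hν1 : ν < 1)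
    (C₁ C₂ C₃ C₄ s₀ s₁ : ℝ)
    (hC₁ : 0 < C₁) (hC₂ : 0 < C₂) (hC₃ : 0 < C₃) (hC₄ : 0 < C₄) (hs₀ : 0 < s₀)
    (hG : ∀ s : ℝ, s₀ < s → ∀ N : ℕ, s₁ + ν / Real.log 2 * Real.log s < (N : ℝ) →
      C₁ * Real.exp (-(C₂ * s ^ ν)) ≤ ∫ x, Real.exp (-(s * x)) ∂(μ N) ∧
      (∫ x, Real.exp (-(s * x)) ∂(μ N)) ≤ C₃ * Real.exp (-(C₄ * s ^ ν))) :
    ∃ C₅ > (0:ℝ), ∃ C₆ > (0:ℝ),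
      ∀ α : ℕ → ℝ, (∀ N, 0 < α N) →
        Tendsto α atTop (nhds 0) →
        Tendsto (fun N : ℕ => (2:ℝ) ^ ((N : ℝ) * (1 - ν) / ν) * α N) atTop atTop →
        -C₅ ≤ liminf (fun N : ℕ =>
            (α N) ^ (ν / (1 - ν)) * Real.log ((μ N (Set.Icc 0 (α N))).toReal)) atTop ∧
        liminf (fun N : ℕ =>
            (α N) ^ (ν / (1 - ν)) * Real.log ((μ N (Set.Icc 0 (α N))).toReal)) atTop ≤
          limsup (fun N : ℕ =>
            (α N) ^ (ν / (1 - ν)) * Real.log ((μ N (Set.Icc 0 (α N))).toReal)) atTop ∧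
        limsup (fun N : ℕ =>
            (α N) ^ (ν / (1 - ν)) * Real.log ((μ N (Set.Icc 0 (α N))).toReal)) atTop ≤ -C₆ := by
  have hν : 0 < 1 - ν := sub_pos.2 hν1
  obtain ⟨K, hK, hKeq⟩ := exists_pos_eq_mul_rpow hν1 (c := 2 * C₂) (by positivity)
  obtain ⟨L, hL, hLeq⟩ := exists_pos_eq_mul_rpow hν1 (c := C₄ / 2) (by positivity)
  refine ⟨K, hK, L / 2, by positivity, fun α hpos hα hgrow => ?_⟩
  set f : ℕ → ℝ := fun N =>
    α N ^ (ν / (1 - ν)) * Real.log ((μ N (Set.Icc 0 (α N))).toReal) with hf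
  have hT := tendsto_rpow_neg_atTop_of_tendsto_zero hpos hα (div_pos hν0 hν)
  have hscale : ∀ {c : ℝ}, 0 < c → ∀ᶠ N in atTop, s₀ < c * α N ^ (-(1 / (1 - ν))) :=
    fun hc => ((tendsto_rpow_neg_atTop_of_tendsto_zero hpos hα
      (one_div_pos.2 hν)).const_mul_atTop hc).eventually_gt_atTop s₀
  have hf_eq : ∀ N, f N * α N ^ (-(ν / (1 - ν))) = Real.log ((μ N).real (Set.Icc 0 (α N))) := by
    intro N
    have hne : α N ^ (ν / (1 - ν)) ≠ 0 := (Real.rpow_pos_of_pos (hpos N) _).ne'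
    rw [hf, Real.rpow_neg (hpos N).le, Measure.real]
    field_simp
  have hlower : ∀ᶠ N in atTop, C₁ / 2 * Real.exp (-(K / 2 * α N ^ (-(ν / (1 - ν))))) ≤
      (μ N).real (Set.Icc 0 (α N)) := by
    filter_upwards [hscale hK, eventually_log_scale_lt hν0 hν1 hpos hgrow hK s₁,
      (hT.const_mul_atTop (half_pos hK)).eventually_ge_atTop (-Real.log (C₁ / 2))]
      with N hs hN hbig
    have := hprob N
    have hG₁ := (hG _ hs N hN).1
    have hle := laplace_le_measureReal_Icc_add_exp (hsupp N) (hs₀.trans hs).le (α N)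
    rw [scale_mul_self hν1 (hpos N)] at hle
    rw [scale_rpow (hpos N) hK] at hG₁
    set T := α N ^ (-(ν / (1 - ν)))
    have hexp : C₂ * (K ^ ν * T) = K / 2 * T := by
      linear_combination (-T / 2) * hKeq
    rw [hexp] at hG₁
    have hsmall : Real.exp (-(K * T)) ≤ C₁ / 2 * Real.exp (-(K / 2 * T)) := by
      rw [← Real.exp_log (half_pos hC₁), ← Real.exp_add, Real.exp_le_exp]
      linarith
    linarith
  have hge : ∀ᶠ N in atTop, -K ≤ f N := by
    filter_upwards [hlower,
      (hT.const_mul_atTop (half_pos hK)).eventually_ge_atTop (-Real.log (C₁ / 2))] with N hN hbig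
    have hTpos := Real.rpow_pos_of_pos (hpos N) (-(ν / (1 - ν)))
    have hlog := Real.log_le_log (by positivity) hN
    rw [Real.log_mul (by positivity) (by positivity), Real.log_exp, ← hf_eq] at hlog
    refine le_of_mul_le_mul_right ?_ hTpos
    linarith
  have hle : ∀ᶠ N in atTop, f N ≤ -(L / 2) := by
    filter_upwards [hlower, hscale hL, eventually_log_scale_lt hν0 hν1 hpos hgrow hL s₁,
      (hT.const_mul_atTop (half_pos hL)).eventually_ge_atTop (Real.log C₃)]
      with N hN hs hsN hbig
    have := hprob N
    have hTpos := Real.rpow_pos_of_pos (hpos N) (-(ν / (1 - ν)))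
    have hμpos : 0 < (μ N).real (Set.Icc 0 (α N)) := lt_of_lt_of_le (by positivity) hN
    have hμle := (measureReal_Icc_le_exp_mul_laplace (hsupp N) (hs₀.trans hs).le (α N)).trans
      (mul_le_mul_of_nonneg_left (hG _ hs N hsN).2 (Real.exp_pos _).le)
    have hlog := Real.log_le_log hμpos hμle
    rw [Real.log_mul (by positivity) (by positivity), Real.log_mul hC₃.ne' (by positivity),
      Real.log_exp, Real.log_exp, scale_mul_self hν1 (hpos N), scale_rpow (hpos N) hL,
      ← hf_eq] at hlog
    set T := α N ^ (-(ν / (1 - ν)))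
    have hexp : C₄ * (L ^ ν * T) = 2 * (L * T) := by
      linear_combination (-2 * T) * hLeq
    refine le_of_mul_le_mul_right ?_ hTpos
    linarith
  have hbdd_above : IsBoundedUnder (· ≤ ·) atTop f := isBoundedUnder_of_eventually_le hle
  have hbdd_below : IsBoundedUnder (· ≥ ·) atTop f := isBoundedUnder_of_eventually_ge hge
  exact ⟨le_liminf_of_le hbdd_above.isCoboundedUnder_ge hge,
    liminf_le_limsup hbdd_above hbdd_below,
    limsup_le_of_le hbdd_below.isCoboundedUnder_le hle⟩
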